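/- Let G be a strongly connected simple directed graph on n > 1 vertices, let w ∈ Sp(V), let 𝒢_i ⊋ 𝒢_j be principal subsets of the set of cycles of G, and set 𝒢' := 𝒢_i − 𝒢_j. If L(𝒢_i) ⊋ L(𝒢_j) and Co(𝒢') ∩ L(𝒢_j) = ∅, then Co(𝒢_i) ∩ Co(𝒢_j) = ∅. -/

import Mathlib

open Matrix Finset
open scoped Classical

noncomputable section

/-- `A` is an infinitesimal stochastic matrix (ISM): all off-diagonal entries are
nonnegative and every row sums to zero. -/
def IsISM {n : ℕ} (A : Matrix (Fin n) (Fin n) ℝ) : Prop :=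
  (∀ i j, i ≠ j → 0 ≤ A i j) ∧ ∀ i, ∑ j, A i j = 0

/-- `A` has the zero pattern prescribed by the digraph with edge relation `E`:
`A i j = 0` whenever `i ≠ j` and `i → j` is not an edge. -/
def InPattern {n : ℕ} (E : Fin n → Fin n → Prop) (A : Matrix (Fin n) (Fin n) ℝ) : Prop :=
  ∀ i j, i ≠ j → ¬ E i j → A i j = 0

/-- `r` is a root of the digraph `E`: every vertex has a directed path to `r`. -/
def IsRootOf {n : ℕ} (E : Fin n → Fin n → Prop) (r : Fin n) : Prop :=
  ∀ i, Relation.ReflTransGen E i r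

/-- The digraph `E` is rooted. -/
def Rooted {n : ℕ} (E : Fin n → Fin n → Prop) : Prop :=
  ∃ r, IsRootOf E r

/-- `w` lies in the standard simplex `Sp[V]`. -/
def MemSimplex {n : ℕ} (w : Fin n → ℝ) : Prop :=
  (∀ i, 0 ≤ w i) ∧ ∑ i, w i = 1

/-- `0` is a simple eigenvalue of `A`: it is a root of multiplicity exactly one of
the characteristic polynomial of `A`. -/
def SimpleZeroEig {n : ℕ} (A : Matrix (Fin n) (Fin n) ℝ) : Prop :=
  Polynomial.rootMultiplicity 0 (Matrix.charpoly A) = 1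

/-- `A ∈ 𝔸_G(w)`: the set of `w`-feasible dynamics. -/
def Feasible {n : ℕ} (E : Fin n → Fin n → Prop) (w : Fin n → ℝ)
    (A : Matrix (Fin n) (Fin n) ℝ) : Prop :=
  IsISM A ∧ InPattern E A ∧ SimpleZeroEig A ∧ Aᵀ *ᵥ w = 0

/-- `S` is a relevant subset of the digraph `E`: it consists of roots and the induced
subgraph on `S` is strongly connected (paths staying inside `S`). -/
def RelevantSubset {n : ℕ} (E : Fin n → Fin n → Prop) (S : Set (Fin n)) : Prop :=
  (∀ i ∈ S, IsRootOf E i) ∧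
    ∀ i ∈ S, ∀ j ∈ S, Relation.ReflTransGen (fun a b => E a b ∧ a ∈ S ∧ b ∈ S) i j

/-- `c` is (the edge relation of) a cycle of the digraph `E`: there are distinct
vertices `v 0, …, v (m+1)` (hence at least two of them), each edge `v t → v (t+1)`
(indices cyclic) is an edge of `E`, and the edges of `c` are exactly these edges. -/
def IsCycleOf {n : ℕ} (E : Fin n → Fin n → Prop) (c : Fin n → Fin n → Prop) : Prop :=
  ∃ (m : ℕ) (v : Fin (m + 2) → Fin n), Function.Injective v ∧
    (∀ t, E (v t) (v (t + 1))) ∧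
    ∀ i j, c i j ↔ ∃ t, v t = i ∧ v (t + 1) = j

/-- The ISM associated with a cycle `c` and the weight vector `w`: off-diagonal
entries are `1 / w j` on the edges of the cycle and `0` otherwise, and the diagonal
entries are chosen so that every row sums to zero. -/
noncomputable def cycleISM {n : ℕ} (w : Fin n → ℝ) (c : Fin n → Fin n → Prop) :
    Matrix (Fin n) (Fin n) ℝ :=
  Matrix.of fun i j =>
    if i = j then -(∑ l ∈ Finset.univ.erase i, if c i l then (w i)⁻¹ else 0)
    else if c i j then (w i)⁻¹ else 0

/-- Given an enumeration `Gc` of the cycles of a digraph on `Fin n`, a set `S` of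
indices of cycles is principal if the digraph whose edge set is the union of the
edge sets of the chosen cycles is strongly connected. -/
def PrincipalSubset {n k : ℕ} (Gc : Fin k → Fin n → Fin n → Prop) (S : Finset (Fin k)) : Prop :=
  ∀ i j : Fin n, Relation.ReflTransGen (fun a b => ∃ s ∈ S, Gc s a b) i j

/-- `Co(𝒢')`: the set of strictly positive linear combinations of the matrices
`C s`, `s ∈ S`. -/
def coOpen {n k : ℕ} (C : Fin k → Matrix (Fin n) (Fin n) ℝ) (S : Finset (Fin k)) :
    Set (Matrix (Fin n) (Fin n) ℝ) :=
  {A | ∃ α : Fin k → ℝ, (∀ s ∈ S, 0 < α s) ∧ A = ∑ s ∈ S, α s • C s}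

/-- Positive combinations over `S` lie in the span of the generators indexed by `S`. -/
theorem coOpen_subset_span {n k : ℕ} (C : Fin k → Matrix (Fin n) (Fin n) ℝ)
    (S : Finset (Fin k)) :
    coOpen C S ⊆ Submodule.span ℝ (C '' (↑S : Set (Fin k))) := by
  rintro A ⟨α, -, rfl⟩
  exact Submodule.sum_mem _ fun s hs =>
    Submodule.smul_mem _ _ (Submodule.subset_span ⟨s, hs, rfl⟩)

/-- If an open cone over `S₁ ⊇ S₂` meets the span over `S₂`, so does the open cone over
`S₁ \ S₂`. -/
theorem coOpen_sdiff_inter_span_nonempty {n k : ℕ} (C : Fin k → Matrix (Fin n) (Fin n) ℝ)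
    {S₁ S₂ : Finset (Fin k)} (h : S₂ ⊆ S₁) {A : Matrix (Fin n) (Fin n) ℝ}
    (hA : A ∈ coOpen C S₁) (hL : A ∈ Submodule.span ℝ (C '' (↑S₂ : Set (Fin k)))) :
    (coOpen C (S₁ \ S₂) ∩ (Submodule.span ℝ (C '' (↑S₂ : Set (Fin k))) :
      Set (Matrix (Fin n) (Fin n) ℝ))).Nonempty := by
  obtain ⟨α, hα, rfl⟩ := hA
  refine ⟨∑ s ∈ S₁ \ S₂, α s • C s,
    ⟨α, fun s hs => hα s (Finset.mem_sdiff.1 hs).1, rfl⟩, ?_⟩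
  rw [← Finset.sum_sdiff h] at hL
  refine (Submodule.add_mem_iff_left _ ?_).1 hL
  exact coOpen_subset_span C S₂ ⟨α, fun s hs => hα s (h hs), rfl⟩

/-- Lemma 5, case 3: for principal subsets with `𝒢_j ⊊ 𝒢_i`, if `L(𝒢_j) ⊊ L(𝒢_i)`
and `Co(𝒢_i − 𝒢_j)` does not meet `L(𝒢_j)`, then `Co(𝒢_i) ∩ Co(𝒢_j) = ∅`. -/
theorem coOpen_disjoint_of_span_lt_of_not_meets
    (n k : ℕ) (hn : 1 < n)
    (E : Fin n → Fin n → Prop) (hsimple : ∀ i, ¬ E i i)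
    (hsc : ∀ i j : Fin n, Relation.ReflTransGen E i j)
    (w : Fin n → ℝ) (hw : ∀ i, 0 < w i) (hw1 : ∑ i, w i = 1)
    (Gc : Fin k → Fin n → Fin n → Prop)
    (hcyc : ∀ t, IsCycleOf E (Gc t)) (hinj : Function.Injective Gc)
    (hall : ∀ c, IsCycleOf E c → ∃ t, Gc t = c)
    (S₁ S₂ : Finset (Fin k))
    (hS₁ : PrincipalSubset Gc S₁) (hS₂ : PrincipalSubset Gc S₂)
    (hss : S₂ ⊂ S₁)
    (hspan : Submodule.span ℝ ((fun t => cycleISM w (Gc t)) '' (↑S₂ : Set (Fin k))) <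
      Submodule.span ℝ ((fun t => cycleISM w (Gc t)) '' (↑S₁ : Set (Fin k))))
    (hmeet : coOpen (fun t => cycleISM w (Gc t)) (S₁ \ S₂) ∩
        (Submodule.span ℝ ((fun t => cycleISM w (Gc t)) '' (↑S₂ : Set (Fin k))) :
          Set (Matrix (Fin n) (Fin n) ℝ)) = ∅) :
    coOpen (fun t => cycleISM w (Gc t)) S₁ ∩ coOpen (fun t => cycleISM w (Gc t)) S₂ = ∅ := by
  refine Set.eq_empty_iff_forall_notMem.2 fun A hA => ?_
  exact (coOpen_sdiff_inter_span_nonempty _ hss.subset hA.1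
    (coOpen_subset_span _ S₂ hA.2)).ne_empty hmeet
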